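/- arXiv:2212.09924 — 2 statements merged into one kernel-verified Lean document; each statement's English description precedes it below -/
import Mathlib

section
/- Let n = 2l+1 be an odd positive integer. Define permutations r₁, r₂, r₃ of the set {1, 2, …, n} by: r₁(i) = n+1−i for all i (so r₁ = (1,n)(2,n−1)⋯(l,l+2) and r₁ fixes l+1); r₂(1) = 1 and r₂(i) = n+2−i for 2 ≤ i ≤ n (so r₂ = (2,n)(3,n−1)⋯(l+1,l+2)); r₃(1) = 1, r₃(n) = n, and r₃(i) = n+1−i for 2 ≤ i ≤ n−1 (so r₃ = (2,n−1)(3,n−2)⋯(l,l+2) and r₃ fixes l+1). Then the symmetric group Sym_n on {1, 2, …, n} is generated by r₁, r₂, and r₃. -/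
/-- For `n = 2l+1` odd, the symmetric group on `{1, …, n}` (modeled as
`Equiv.Perm (Fin n)`, 0-indexed) is generated by the three involutions
`r₁ = (1,n)(2,n-1)⋯(l,l+2)`, `r₂ = (2,n)(3,n-1)⋯(l+1,l+2)`, and
`r₃ = (2,n-1)(3,n-2)⋯(l,l+2)`.  In 1-indexed notation `r₁(j) = n+1-j`
for all `j`; `r₂(1) = 1` and `r₂(j) = n+2-j` for `2 ≤ j ≤ n`;
`r₃(1) = 1`, `r₃(n) = n` and `r₃(j) = n+1-j` for `2 ≤ j ≤ n-1`. -/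
theorem symmetricGroup_generated_by_three_involutions_odd
    (l n : ℕ) (hn : n = 2 * l + 1)
    (r₁ r₂ r₃ : Equiv.Perm (Fin n))
    (h₁ : ∀ i : Fin n, (r₁ i : ℕ) = n - 1 - (i : ℕ))
    (h₂ : ∀ i : Fin n, (r₂ i : ℕ) = if (i : ℕ) = 0 then 0 else n - (i : ℕ))
    (h₃ : ∀ i : Fin n, (r₃ i : ℕ) =
      if (i : ℕ) = 0 ∨ (i : ℕ) = n - 1 then (i : ℕ) else n - 1 - (i : ℕ)) :
    Subgroup.closure {r₁, r₂, r₃} = (⊤ : Subgroup (Equiv.Perm (Fin n))) := by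
  obtain rfl | ⟨m, rfl⟩ : l = 0 ∨ ∃ m, l = m + 1 := by
    cases l <;> simp
  · subst hn
    have : Subsingleton (Fin (2 * 0 + 1)) := Fin.subsingleton_one
    refine eq_top_iff.2 fun σ _ => ?_
    rw [Subsingleton.elim σ 1]
    exact one_mem _
  obtain ⟨k, rfl⟩ : ∃ k, n = k + 2 := ⟨2 * m + 1, by omega⟩
  have hrot : r₂ * r₁ = finRotate (k + 2) := by
    ext i
    rw [Equiv.Perm.mul_apply, h₂, h₁, coe_finRotate]
    simp only [Fin.ext_iff, Fin.val_last]
    split_ifs <;> omega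
  have hswap : r₁ * r₃ = Equiv.swap (Fin.last (k + 1)) (finRotate (k + 2) (Fin.last (k + 1))) := by
    ext i
    rw [Equiv.Perm.mul_apply, h₁, h₃, finRotate_last, Equiv.swap_apply_def]
    simp only [Fin.ext_iff, apply_ite Fin.val, Fin.val_last, Fin.val_zero]
    split_ifs <;> omega
  rw [eq_top_iff, ← Equiv.Perm.closure_cycle_adjacent_swap isCycle_finRotate support_finRotate
    (Fin.last (k + 1)), ← hswap, ← hrot, Subgroup.closure_le]
  have m₁ : r₁ ∈ Subgroup.closure {r₁, r₂, r₃} := Subgroup.subset_closure (by simp)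
  have m₂ : r₂ ∈ Subgroup.closure {r₁, r₂, r₃} := Subgroup.subset_closure (by simp)
  have m₃ : r₃ ∈ Subgroup.closure {r₁, r₂, r₃} := Subgroup.subset_closure (by simp)
  rintro σ (rfl | rfl)
  · exact mul_mem m₂ m₁
  · exact mul_mem m₁ m₃
end

section
/- Let n = 2l be an even positive integer. Define permutations r₁, r₂, r₃ of the set {1, 2, …, n} by: r₁(i) = n+1−i for all i (so r₁ = (1,n)(2,n−1)⋯(l,l+1)); r₂(1) = 1 and r₂(i) = n+2−i for 2 ≤ i ≤ n (so r₂ = (2,n)(3,n−1)⋯(l,l+2) and r₂ fixes 1 and l+1); r₃(1) = 1, r₃(n) = n, and r₃(i) = n+1−i for 2 ≤ i ≤ n−1 (so r₃ = (2,n−1)(3,n−2)⋯(l,l+1) and r₃ fixes 1 and n). Then the symmetric group Sym_n on {1, 2, …, n} is generated by r₁, r₂, and r₃. -/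
/-- For `n = 2l` even and positive, the symmetric group on `{1, …, n}`
(modeled as `Equiv.Perm (Fin n)`, 0-indexed) is generated by the three
involutions `r₁ = (1,n)(2,n-1)⋯(l,l+1)`, `r₂ = (2,n)(3,n-1)⋯(l,l+2)`,
and `r₃ = (2,n-1)(3,n-2)⋯(l,l+1)`.  In 1-indexed notation
`r₁(j) = n+1-j` for all `j`; `r₂(1) = 1` and `r₂(j) = n+2-j` for
`2 ≤ j ≤ n`; `r₃(1) = 1`, `r₃(n) = n` and `r₃(j) = n+1-j` for
`2 ≤ j ≤ n-1`. -/
theorem symmetricGroup_generated_by_three_involutions_even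
    (l n : ℕ) (hl : 1 ≤ l) (hn : n = 2 * l)
    (r₁ r₂ r₃ : Equiv.Perm (Fin n))
    (h₁ : ∀ i : Fin n, (r₁ i : ℕ) = n - 1 - (i : ℕ))
    (h₂ : ∀ i : Fin n, (r₂ i : ℕ) = if (i : ℕ) = 0 then 0 else n - (i : ℕ))
    (h₃ : ∀ i : Fin n, (r₃ i : ℕ) =
      if (i : ℕ) = 0 ∨ (i : ℕ) = n - 1 then (i : ℕ) else n - 1 - (i : ℕ)) :
    Subgroup.closure {r₁, r₂, r₃} = (⊤ : Subgroup (Equiv.Perm (Fin n))) := by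
  obtain ⟨m, rfl⟩ : ∃ m, n = m + 2 := ⟨n - 2, by omega⟩
  have hrot : r₂ * r₁ = finRotate (m + 2) := by
    ext i
    have hi := i.isLt
    rw [Equiv.Perm.mul_apply, h₂, h₁, coe_finRotate]
    simp only [Fin.ext_iff, Fin.val_last]
    split_ifs <;> omega
  have hswap : r₁ * r₃ =
      Equiv.swap (Fin.last (m + 1)) (finRotate (m + 2) (Fin.last (m + 1))) := by
    ext i
    have hi := i.isLt
    rw [Equiv.Perm.mul_apply, h₁, h₃, finRotate_last, Equiv.swap_apply_def]
    simp only [Fin.ext_iff, Fin.val_last, Fin.val_zero]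
    split_ifs <;> simp only [Fin.val_last, Fin.val_zero, *] <;> omega
  rw [← top_le_iff, ← Equiv.Perm.closure_cycle_adjacent_swap isCycle_finRotate
    support_finRotate (Fin.last (m + 1)), ← hswap, ← hrot, Subgroup.closure_le]
  have mem₁ : r₁ ∈ Subgroup.closure {r₁, r₂, r₃} := Subgroup.subset_closure (by simp)
  have mem₂ : r₂ ∈ Subgroup.closure {r₁, r₂, r₃} := Subgroup.subset_closure (by simp)
  have mem₃ : r₃ ∈ Subgroup.closure {r₁, r₂, r₃} := Subgroup.subset_closure (by simp)
  rintro _ (rfl | rfl)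
  · exact mul_mem mem₂ mem₁
  · exact mul_mem mem₁ mem₃
end
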